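/- Let Λ ⊂ ℂ^g be the lattice Λ = {ωm + ω'n : m, n ∈ ℤ^g} for invertible g×g period matrices ω, ω' with Ω = ω⁻¹ω' in the Siegel upper half-space, let η, η' ∈ ℂ^{g×g}, and define σ(u) = exp((1/2)uᵀω⁻¹ηu)·θ[α;β](ω⁻¹u; Ω) and ζ(u) = ∇_u log σ(u). Then the completed function ζ̂(u) = ζ(u) − (1/2)uᵀ(ω⁻¹η + ηᵀω⁻ᵀ) + 2πi·Im(ω⁻¹u)ᵀ·Im(Ω)⁻¹·ω⁻¹ satisfies ζ̂(u + ℓ) = ζ̂(u) for every lattice point ℓ = ωλ + ω'μ ∈ Λ (λ, μ ∈ ℤ^g), wherever both sides are defined (i.e., where σ does not vanish). -/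

import Mathlib

open Complex Matrix

noncomputable section

/-- e(x) = exp(2πix) -/
def e (x : ℂ) : ℂ := Complex.exp (2 * Real.pi * Complex.I * x)

/-- The Riemann theta function with characteristic [α;β]. -/
def theta {g : ℕ} (α β : Fin g → ℝ) (u : Fin g → ℂ) (Ω : Matrix (Fin g) (Fin g) ℂ) : ℂ :=
  ∑' m : Fin g → ℤ,
    e ((fun i => (m i : ℂ) + (α i : ℂ)) ⬝ᵥ (fun i => u i + (β i : ℂ))
      + (1/2) * ((fun i => (m i : ℂ) + (α i : ℂ)) ⬝ᵥ
          Ω.mulVec (fun i => (m i : ℂ) + (α i : ℂ))))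

/-- Wirtinger derivative ∂/∂u_j. -/
def wder {g : ℕ} (F : (Fin g → ℂ) → ℂ) (u : Fin g → ℂ) (j : Fin g) : ℂ :=
  (fderiv ℝ F u (Pi.single j 1) - Complex.I * fderiv ℝ F u (Pi.single j Complex.I)) / 2

/-- The Kleinian sigma function σ(u) = exp((1/2)uᵀω⁻¹ηu)·θ[α;β](ω⁻¹u; ω⁻¹ω'). -/
def kleinSigma {g : ℕ} (α β : Fin g → ℝ) (ω ω' η : Matrix (Fin g) (Fin g) ℂ)
    (u : Fin g → ℂ) : ℂ :=
  Complex.exp ((1/2) * (u ⬝ᵥ (ω⁻¹ * η).mulVec u)) * theta α β (ω⁻¹.mulVec u) (ω⁻¹ * ω')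

/-- The Kleinian zeta function ζ(u) = ∇_u log σ(u) (as ∇σ/σ). -/
def kleinZeta {g : ℕ} (α β : Fin g → ℝ) (ω ω' η : Matrix (Fin g) (Fin g) ℂ)
    (u : Fin g → ℂ) (j : Fin g) : ℂ :=
  wder (kleinSigma α β ω ω' η) u j / kleinSigma α β ω ω' η u

/-- The completed Kleinian zeta function
ζ̂(u) = ζ(u) − (1/2)uᵀ(ω⁻¹η + ηᵀω⁻ᵀ) + 2πi·Im(ω⁻¹u)ᵀ·Im(Ω)⁻¹·ω⁻¹. -/
def kleinZetaHat {g : ℕ} (α β : Fin g → ℝ) (ω ω' η : Matrix (Fin g) (Fin g) ℂ)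
    (u : Fin g → ℂ) (j : Fin g) : ℂ :=
  kleinZeta α β ω ω' η u j
    - (1/2) * Matrix.vecMul u (ω⁻¹ * η + ηᵀ * (ω⁻¹)ᵀ) j
    + 2 * Real.pi * Complex.I *
        Matrix.vecMul
          (fun i => ((Matrix.vecMul (fun k => ((ω⁻¹.mulVec u) k).im)
            (((ω⁻¹ * ω').map Complex.im)⁻¹) i : ℝ) : ℂ)) ω⁻¹ j

/-- A positive definite form dominates a multiple of the sum of squares. -/
lemma kz_form_lower {g : ℕ} (Y : Matrix (Fin g) (Fin g) ℝ) (hY : Y.PosDef) :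
    ∃ c : ℝ, 0 < c ∧ ∀ x : Fin g → ℝ, c * ∑ i, x i ^ 2 ≤ x ⬝ᵥ Y.mulVec x := by
  have hcont : Continuous fun x : Fin g → ℝ => x ⬝ᵥ Y.mulVec x := by
    simp only [dotProduct, mulVec]; fun_prop
  have hpos : ∀ x : Fin g → ℝ, x ≠ 0 → 0 < x ⬝ᵥ Y.mulVec x := fun x hx => by
    simpa using hY.dotProduct_mulVec_pos hx
  obtain ⟨c, hc, h⟩ : ∃ c : ℝ, 0 < c ∧ ∀ x ∈ Metric.sphere (0 : Fin g → ℝ) 1,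
      c ≤ x ⬝ᵥ Y.mulVec x := by
    apply (isCompact_sphere (0 : Fin g → ℝ) 1).exists_forall_le' hcont.continuousOn
    intro x hx
    apply hpos
    rintro rfl
    simp at hx
  refine ⟨c / (g + 1), by positivity, fun x => ?_⟩
  by_cases hx : x = 0
  · subst hx; simp
  have hn : 0 < ‖x‖ := norm_pos_iff.mpr hx
  have h1 := h (‖x‖⁻¹ • x) (by simp [norm_smul, hn.ne'])
  rw [mulVec_smul, dotProduct_smul, smul_dotProduct, smul_eq_mul, smul_eq_mul] at h1
  have h2 : c * ‖x‖ ^ 2 ≤ x ⬝ᵥ Y.mulVec x := by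
    have := mul_le_mul_of_nonneg_right h1 (sq_nonneg ‖x‖)
    field_simp at this
    linarith
  have h3 : ∑ i, x i ^ 2 ≤ g * ‖x‖ ^ 2 := by
    calc ∑ i, x i ^ 2 ≤ ∑ i : Fin g, ‖x‖ ^ 2 := by
          apply Finset.sum_le_sum
          intro i _
          rw [← sq_abs]
          have := norm_le_pi_norm x i
          rw [Real.norm_eq_abs] at this
          gcongr
      _ = g * ‖x‖ ^ 2 := by simp
  have h4 : c / (g + 1) * (g * ‖x‖ ^ 2) ≤ c * ‖x‖ ^ 2 := by
    rw [div_mul_eq_mul_div, div_le_iff₀ (by positivity)]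
    nlinarith [mul_pos hc (pow_pos hn 2)]
  have h5 := mul_le_mul_of_nonneg_left h3 (show 0 ≤ c / ((g : ℝ) + 1) by positivity)
  linarith

lemma kz_summable_one (K c a : ℝ) (hK : 0 ≤ K) (hc : 0 < c) :
    Summable fun n : ℤ => Real.exp (K * |(n : ℝ) + a| - c * ((n : ℝ) + a) ^ 2) := by
  have h := (summable_pow_mul_jacobiTheta₂_term_bound (K / (2 * Real.pi))
    (T := c / (2 * Real.pi)) (by positivity) 0).mul_left (Real.exp (K * |a| + c * a ^ 2))
  refine Summable.of_nonneg_of_le (fun _ => (Real.exp_pos _).le) (fun n => ?_) h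
  rw [pow_zero, one_mul, ← Real.exp_add, Real.exp_le_exp]
  have e1 : -Real.pi * (c / (2 * Real.pi) * (n : ℝ) ^ 2 - 2 * (K / (2 * Real.pi)) * |(n : ℝ)|)
      = K * |(n : ℝ)| - c / 2 * (n : ℝ) ^ 2 := by
    have := Real.pi_pos.ne'
    field_simp
    ring
  push_cast
  rw [e1]
  have h1 := mul_le_mul_of_nonneg_left (abs_add_le (n : ℝ) a) hK
  have h2 : 0 ≤ c * ((n : ℝ) + 2 * a) ^ 2 := by positivity
  nlinarith

lemma kz_summable_prod : ∀ (g : ℕ) (h : Fin g → ℤ → ℝ), (∀ i n, 0 ≤ h i n) →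
    (∀ i, Summable (h i)) → Summable fun m : Fin g → ℤ => ∏ i, h i (m i)
  | 0, _, _, _ => Summable.of_finite
  | g + 1, h, h0, hs => by
    have ih := kz_summable_prod g (fun i => h i.succ) (fun i => h0 _) (fun i => hs _)
    have := (hs 0).mul_of_nonneg ih (fun n => h0 _ n)
      (fun m => Finset.prod_nonneg fun i _ => h0 _ _)
    rw [← (Fin.consEquiv fun _ : Fin (g + 1) => ℤ).summable_iff]
    refine this.congr fun p => ?_
    simp [Fin.prod_univ_succ, Fin.consEquiv]

lemma kz_norm_term {g : ℕ} (x : Fin g → ℝ) (w : Fin g → ℂ) (Ω : Matrix (Fin g) (Fin g) ℂ) :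
    ‖e ((fun i => (x i : ℂ)) ⬝ᵥ w + (1/2) * ((fun i => (x i : ℂ)) ⬝ᵥ
      Ω.mulVec (fun i => (x i : ℂ))))‖ =
    Real.exp (-2 * Real.pi * (∑ i, x i * (w i).im)
      - Real.pi * (x ⬝ᵥ (Ω.map Complex.im).mulVec x)) := by
  rw [e, Complex.norm_exp]
  congr 1
  have h1 : ((fun i => (x i : ℂ)) ⬝ᵥ w).im = ∑ i, x i * (w i).im := by
    simp [dotProduct]
  have h2 : ((fun i => (x i : ℂ)) ⬝ᵥ Ω.mulVec (fun i => (x i : ℂ))).im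
      = x ⬝ᵥ (Ω.map Complex.im).mulVec x := by
    simp [dotProduct, mulVec]
  have h3 : ∀ z w : ℂ, (2 * Real.pi * Complex.I * (z + (1/2) * w)).re
      = -2 * Real.pi * z.im - Real.pi * w.im := by
    intro z w
    have : (2 * Real.pi * Complex.I * (z + (1/2) * w))
      = ((2 * Real.pi : ℝ) : ℂ) * z * Complex.I + ((Real.pi : ℝ) : ℂ) * w * Complex.I := by
        push_cast; ring
    rw [this]
    simp
    ring
  rw [h3, h1, h2]

lemma kz_theta_differentiable {g : ℕ} (α β : Fin g → ℝ) (Ω : Matrix (Fin g) (Fin g) ℂ)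
    (hpos : (Ω.map Complex.im).PosDef) :
    Differentiable ℂ fun v => theta α β v Ω := by
  intro v₀
  obtain ⟨c, hc, hcl⟩ := kz_form_lower _ hpos
  set R : ℝ := ‖v₀‖ + 1 with hR
  have hR0 : 0 < R := by positivity
  set K : ℝ := 2 * Real.pi * R + 1 with hK
  have hK0 : 0 ≤ K := by positivity
  set B : (Fin g → ℤ) → ℝ := fun m =>
    ∏ i, Real.exp (K * |(m i : ℝ) + α i| - (Real.pi * c) * ((m i : ℝ) + α i) ^ 2) with hB
  have hBs : Summable B := kz_summable_prod g
    (fun i n => Real.exp (K * |(n : ℝ) + α i| - (Real.pi * c) * ((n : ℝ) + α i) ^ 2))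
    (fun _ _ => (Real.exp_pos _).le)
    (fun i => kz_summable_one K (Real.pi * c) (α i) hK0 (by positivity))
  set f : (Fin g → ℤ) → (Fin g → ℂ) → ℂ := fun m u =>
    e ((fun i => (m i : ℂ) + (α i : ℂ)) ⬝ᵥ (fun i => u i + (β i : ℂ))
      + (1/2) * ((fun i => (m i : ℂ) + (α i : ℂ)) ⬝ᵥ
          Ω.mulVec (fun i => (m i : ℂ) + (α i : ℂ)))) with hf
  set L : (Fin g → ℤ) → ((Fin g → ℂ) →L[ℂ] ℂ) := fun m =>
    ∑ i, ((m i : ℂ) + (α i : ℂ)) • ContinuousLinearMap.proj (R := ℂ) (φ := fun _ : Fin g => ℂ) i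
    with hL
  set f' : (Fin g → ℤ) → (Fin g → ℂ) → ((Fin g → ℂ) →L[ℂ] ℂ) := fun m u =>
    f m u • ((2 * Real.pi * Complex.I) • L m) with hf'
  have hcast : ∀ (m : Fin g → ℤ) i, (m i : ℂ) + (α i : ℂ) = (((m i : ℝ) + α i : ℝ) : ℂ) := by
    intro m i; push_cast; rfl
  have hnorm : ∀ m u, u ∈ Metric.ball (0 : Fin g → ℂ) R →
      ‖f m u‖ * Real.exp (∑ i, |(m i : ℝ) + α i|) ≤ B m := by
    intro m u hu
    have hu1 : ‖u‖ ≤ R := by simpa using (mem_ball_zero_iff.mp hu).le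
    simp only [hf, hcast, hB]
    rw [kz_norm_term, ← Real.exp_add, ← Real.exp_sum, Real.exp_le_exp,
      Finset.sum_sub_distrib, ← Finset.mul_sum, ← Finset.mul_sum]
    have h1 := mul_le_mul_of_nonneg_left (hcl fun i => (m i : ℝ) + α i) Real.pi_pos.le
    have h2 : -(∑ i, ((m i : ℝ) + α i) * (u i + (β i : ℂ)).im)
        ≤ R * ∑ i, |(m i : ℝ) + α i| := by
      rw [← Finset.sum_neg_distrib, Finset.mul_sum]
      apply Finset.sum_le_sum
      intro i _
      have h3 : |(u i).im| ≤ R :=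
        (Complex.abs_im_le_norm _).trans ((norm_le_pi_norm u i).trans hu1)
      have h4 : (u i + (β i : ℂ)).im = (u i).im := by simp
      rw [h4]
      calc -(((m i : ℝ) + α i) * (u i).im) ≤ |((m i : ℝ) + α i) * (u i).im| := neg_le_abs _
        _ = |(u i).im| * |(m i : ℝ) + α i| := by rw [abs_mul, mul_comm]
        _ ≤ _ := by gcongr
    have h5 := mul_le_mul_of_nonneg_left h2 (show 0 ≤ 2 * Real.pi by positivity)
    rw [hK]
    linarith
  have hmem : v₀ ∈ Metric.ball (0 : Fin g → ℂ) R := by simp [hR]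
  have key := hasFDerivAt_tsum_of_isPreconnected (𝕜 := ℂ) (f := f) (f' := f')
    (u := fun m => 2 * Real.pi * B m) (hBs.mul_left _) (s := Metric.ball 0 R)
    Metric.isOpen_ball (convex_ball _ _).isPreconnected (x₀ := v₀) (x := v₀)
    ?_ ?_ hmem ?_ hmem
  · exact key.differentiableAt
  · intro m u _
    have hd : HasFDerivAt (fun u : Fin g → ℂ => 2 * Real.pi * Complex.I *
      ((fun i => (m i : ℂ) + (α i : ℂ)) ⬝ᵥ (fun i => u i + (β i : ℂ))
      + (1/2) * ((fun i => (m i : ℂ) + (α i : ℂ)) ⬝ᵥ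
          Ω.mulVec (fun i => (m i : ℂ) + (α i : ℂ))))) ((2 * Real.pi * Complex.I) • L m) u := by
      apply HasFDerivAt.const_mul
      apply HasFDerivAt.add_const
      simp only [dotProduct]
      apply HasFDerivAt.fun_sum
      intro i _
      apply HasFDerivAt.const_mul
      apply HasFDerivAt.add_const
      exact hasFDerivAt_apply i u
    exact hd.cexp
  · intro m u hu
    have hLn : ‖L m‖ ≤ ∑ i, |(m i : ℝ) + α i| := by
      refine ContinuousLinearMap.opNorm_le_bound _ (Finset.sum_nonneg fun _ _ => abs_nonneg _) ?_
      intro w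
      simp only [hL, _root_.sum_apply, _root_.smul_apply,
        ContinuousLinearMap.proj_apply, smul_eq_mul]
      rw [Finset.sum_mul]
      refine (norm_sum_le _ _).trans (Finset.sum_le_sum fun i _ => ?_)
      rw [norm_mul, hcast, Complex.norm_real, Real.norm_eq_abs]
      gcongr
      exact norm_le_pi_norm w i
    have hLe : ‖L m‖ ≤ Real.exp (∑ i, |(m i : ℝ) + α i|) :=
      hLn.trans (by linarith [Real.add_one_le_exp (∑ i, |(m i : ℝ) + α i|)])
    have hpi : ‖(2 * Real.pi * Complex.I : ℂ)‖ = 2 * Real.pi := by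
      simp [abs_of_pos Real.pi_pos]
    simp only [hf', norm_smul, hpi]
    have := hnorm m u hu
    calc ‖f m u‖ * (2 * Real.pi * ‖L m‖)
        ≤ ‖f m u‖ * (2 * Real.pi * Real.exp (∑ i, |(m i : ℝ) + α i|)) := by gcongr
      _ = 2 * Real.pi * (‖f m u‖ * Real.exp (∑ i, |(m i : ℝ) + α i|)) := by ring
      _ ≤ _ := by gcongr
  · refine Summable.of_norm_bounded hBs fun m => ?_
    refine le_trans ?_ (hnorm m v₀ hmem)
    apply le_mul_of_one_le_right (norm_nonneg _)
    exact Real.one_le_exp (Finset.sum_nonneg fun _ _ => abs_nonneg _)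

lemma kz_theta_quasi {g : ℕ} (α β : Fin g → ℝ) (Ω : Matrix (Fin g) (Fin g) ℂ)
    (hsymm : Ω.IsSymm) (l μ : Fin g → ℤ) (v : Fin g → ℂ) :
    theta α β (v + ((fun i => (l i : ℂ)) + Ω.mulVec (fun i => (μ i : ℂ)))) Ω =
    Complex.exp (2 * Real.pi * Complex.I * ((fun i => (α i : ℂ)) ⬝ᵥ (fun i => (l i : ℂ))
      - (1/2) * ((fun i => (μ i : ℂ)) ⬝ᵥ Ω.mulVec (fun i => (μ i : ℂ)))
      - (fun i => (μ i : ℂ)) ⬝ᵥ (fun i => (β i : ℂ)))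
      + (-(2 * Real.pi * Complex.I)) * ((fun i => (μ i : ℂ)) ⬝ᵥ v)) * theta α β v Ω := by
  unfold theta
  rw [← (Equiv.addRight μ).tsum_eq (fun m : Fin g → ℤ => e ((fun i => (m i : ℂ) + (α i : ℂ)) ⬝ᵥ (fun i => v i + (β i : ℂ))
      + (1/2) * ((fun i => (m i : ℂ) + (α i : ℂ)) ⬝ᵥ
          Ω.mulVec (fun i => (m i : ℂ) + (α i : ℂ))))), ← tsum_mul_left]
  refine tsum_congr fun m => ?_
  rw [Equiv.coe_addRight]
  simp only [e]
  rw [← Complex.exp_add]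
  set x : Fin g → ℂ := fun i => (m i : ℂ) + (α i : ℂ) with hx
  set M : Fin g → ℂ := fun i => (μ i : ℂ) with hM
  have hxm : (fun i => (((m + μ) i : ℤ) : ℂ) + (α i : ℂ)) = x + M := by
    ext i; simp [hx, hM]; ring
  have hvb : (fun i => v i + (β i : ℂ)) = v + (fun i => (β i : ℂ)) := rfl
  have hvb2 : (fun i => (v + ((fun i => (l i : ℂ)) + Ω.mulVec M)) i + (β i : ℂ))
    = v + ((fun i => (l i : ℂ)) + Ω.mulVec M) + (fun i => (β i : ℂ)) := rfl
  have hsw : M ⬝ᵥ Ω.mulVec x = x ⬝ᵥ Ω.mulVec M := by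
    rw [dotProduct_mulVec, ← mulVec_transpose, hsymm.eq, dotProduct_comm]
  have hxl : x ⬝ᵥ (fun i => (l i : ℂ)) = ((∑ i, m i * l i : ℤ) : ℂ)
      + (fun i => (α i : ℂ)) ⬝ᵥ (fun i => (l i : ℂ)) := by
    simp [hx, dotProduct, add_mul, Finset.sum_add_distrib]
  rw [hxm, hvb, hvb2, Complex.exp_eq_exp_iff_exists_int]
  refine ⟨∑ i, m i * l i, ?_⟩
  simp only [dotProduct_add, add_dotProduct, mulVec_add, hsw, hxl]
  ring

lemma kz_wder_eq {g : ℕ} (F : (Fin g → ℂ) → ℂ) (u : Fin g → ℂ) (j : Fin g)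
    (h : DifferentiableAt ℂ F u) : wder F u j = fderiv ℂ F u (Pi.single j 1) := by
  have h1 : (Pi.single j Complex.I : Fin g → ℂ) = Complex.I • Pi.single j 1 := by
    rw [← Pi.single_smul]; simp
  rw [wder, h.fderiv_restrictScalars ℝ]
  simp only [ContinuousLinearMap.coe_restrictScalars', h1, map_smul, smul_eq_mul]
  rw [← mul_assoc, Complex.I_mul_I]
  ring

lemma kz_wder_exp_mul {g : ℕ} (Q G : (Fin g → ℂ) → ℂ) (u : Fin g → ℂ) (j : Fin g)
    (hQ : DifferentiableAt ℂ Q u) (hG : DifferentiableAt ℂ G u) (h0 : G u ≠ 0) :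
    wder (fun u => Complex.exp (Q u) * G u) u j / (Complex.exp (Q u) * G u)
      = fderiv ℂ Q u (Pi.single j 1) + wder G u j / G u := by
  have hd := hQ.hasFDerivAt.cexp.mul hG.hasFDerivAt
  have hd' : HasFDerivAt (fun u => Complex.exp (Q u) * G u) _ u := hd
  rw [kz_wder_eq _ _ _ hd'.differentiableAt, kz_wder_eq _ _ _ hG, hd'.fderiv]
  have := Complex.exp_ne_zero (Q u)
  simp
  field_simp
  ring

lemma kz_fderiv_quad {g : ℕ} (M : Matrix (Fin g) (Fin g) ℂ) (u : Fin g → ℂ) (j : Fin g) :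
    DifferentiableAt ℂ (fun u : Fin g → ℂ => (1/2 : ℂ) * (u ⬝ᵥ M.mulVec u)) u ∧
    fderiv ℂ (fun u : Fin g → ℂ => (1/2 : ℂ) * (u ⬝ᵥ M.mulVec u)) u (Pi.single j 1)
      = (1/2) * Matrix.vecMul u (M + Mᵀ) j := by
  have hd : DifferentiableAt ℂ (fun u : Fin g → ℂ => (1/2 : ℂ) * (u ⬝ᵥ M.mulVec u)) u := by
    simp only [dotProduct, mulVec]; fun_prop
  refine ⟨hd, ?_⟩
  rw [← hd.lineDeriv_eq_fderiv, lineDeriv]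
  set w : Fin g → ℂ := Pi.single j 1 with hw
  have h1 : (fun t : ℂ => (1/2 : ℂ) * ((u + t • w) ⬝ᵥ M.mulVec (u + t • w)))
    = fun t : ℂ => (1/2 : ℂ) * (u ⬝ᵥ M.mulVec u) + t * ((1/2) * Matrix.vecMul u (M + Mᵀ) j)
      + t ^ 2 * ((1/2) * (w ⬝ᵥ M.mulVec w)) := by
    funext t
    have h2 : Matrix.vecMul u (M + Mᵀ) j = u ⬝ᵥ M.mulVec w + w ⬝ᵥ M.mulVec u := by
      rw [vecMul_add, Pi.add_apply, vecMul_transpose, dotProduct_mulVec, hw]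
      simp
    rw [h2]
    simp only [mulVec_add, mulVec_smul, dotProduct_add, add_dotProduct, smul_dotProduct,
      dotProduct_smul, smul_eq_mul]
    ring
  rw [h1]
  have h3 := (((hasDerivAt_id (0 : ℂ)).mul_const ((1/2) * Matrix.vecMul u (M + Mᵀ) j)).const_add
    ((1/2 : ℂ) * (u ⬝ᵥ M.mulVec u))).add
    (((hasDerivAt_id (0 : ℂ)).pow 2).mul_const ((1/2) * (w ⬝ᵥ M.mulVec w)))
  refine (HasDerivAt.deriv h3).trans ?_
  simp

lemma kz_wder_translate {g : ℕ} (G : (Fin g → ℂ) → ℂ) (u l : Fin g → ℂ) (j : Fin g) :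
    wder (fun u => G (u + l)) u j = wder G (u + l) j := by
  simp only [wder, fderiv_comp_add_right]

/-- the completed Kleinian zeta function ζ̂ is invariant under
translation by lattice points ℓ = ωλ + ω'μ of Λ = ωℤ^g + ω'ℤ^g, wherever σ does
not vanish. -/
theorem kleinZetaHat_lattice_invariant {g : ℕ} (α β : Fin g → ℝ)
    (ω ω' η : Matrix (Fin g) (Fin g) ℂ) (hω : IsUnit ω.det)
    (hsymm : (ω⁻¹ * ω').IsSymm) (hpos : ((ω⁻¹ * ω').map Complex.im).PosDef)
    (lam mu : Fin g → ℤ) (u : Fin g → ℂ)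
    (hu : kleinSigma α β ω ω' η u ≠ 0)
    (hu' : kleinSigma α β ω ω' η
      (u + (ω.mulVec (fun i => (lam i : ℂ)) + ω'.mulVec (fun i => (mu i : ℂ)))) ≠ 0) :
    kleinZetaHat α β ω ω' η
        (u + (ω.mulVec (fun i => (lam i : ℂ)) + ω'.mulVec (fun i => (mu i : ℂ))))
      = kleinZetaHat α β ω ω' η u := by
  set l : Fin g → ℂ := ω.mulVec (fun i => (lam i : ℂ)) + ω'.mulVec (fun i => (mu i : ℂ)) with hl
  set M : Fin g → ℂ := fun i => (mu i : ℂ) with hM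
  set G : (Fin g → ℂ) → ℂ := fun u => theta α β (ω⁻¹.mulVec u) (ω⁻¹ * ω') with hG
  have hGd : Differentiable ℂ G := by
    have hlin : Differentiable ℂ fun u : Fin g → ℂ => ω⁻¹.mulVec u :=
      (LinearMap.toContinuousLinearMap ω⁻¹.mulVecLin).differentiable
    exact (kz_theta_differentiable α β _ hpos).comp hlin
  have hsig : ∀ u, kleinSigma α β ω ω' η u
      = Complex.exp ((1/2) * (u ⬝ᵥ (ω⁻¹ * η).mulVec u)) * G u := fun _ => rfl
  have hinv : ω⁻¹ * ω = 1 := Matrix.nonsing_inv_mul _ hω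
  have hil : ω⁻¹.mulVec l = (fun i => (lam i : ℂ)) + (ω⁻¹ * ω').mulVec M := by
    rw [hl, mulVec_add, mulVec_mulVec, mulVec_mulVec, hinv, one_mulVec]
  -- zeta in terms of the logarithmic derivative of G
  have hz : ∀ u j, G u ≠ 0 → kleinZeta α β ω ω' η u j
      = (1/2) * Matrix.vecMul u (ω⁻¹ * η + ηᵀ * (ω⁻¹)ᵀ) j + wder G u j / G u := by
    intro u j h0
    obtain ⟨hq, hq'⟩ := kz_fderiv_quad (ω⁻¹ * η) u j
    rw [transpose_mul] at hq'
    rw [← hq', ← kz_wder_exp_mul _ _ u j hq (hGd u) h0]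
    rfl
  have hG0 : G u ≠ 0 := by
    rw [hsig] at hu; exact right_ne_zero_of_mul hu
  have hG1 : G (u + l) ≠ 0 := by
    rw [hsig] at hu'; exact right_ne_zero_of_mul hu'
  obtain ⟨C, hquasi⟩ : ∃ C : ℂ, ∀ u, G (u + l) =
      Complex.exp (C + (-(2 * Real.pi * Complex.I)) * (M ⬝ᵥ ω⁻¹.mulVec u)) * G u := by
    refine ⟨2 * Real.pi * Complex.I * ((fun i => (α i : ℂ)) ⬝ᵥ (fun i => (lam i : ℂ))
      - (1/2) * (M ⬝ᵥ (ω⁻¹ * ω').mulVec M) - M ⬝ᵥ (fun i => (β i : ℂ))), fun u => ?_⟩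
    simp only [hG]
    rw [mulVec_add, hil]
    exact kz_theta_quasi α β _ hsymm lam mu _
  ext j
  have hlog : wder G (u + l) j / G (u + l)
      = -(2 * Real.pi * Complex.I) * Matrix.vecMul M ω⁻¹ j + wder G u j / G u := by
    rw [← kz_wder_translate, funext hquasi, hquasi u]
    have hlin : HasFDerivAt (fun u : Fin g → ℂ =>
        C + (-(2 * Real.pi * Complex.I)) * (M ⬝ᵥ ω⁻¹.mulVec u))
        ((-(2 * Real.pi * Complex.I)) • (∑ i, (Matrix.vecMul M ω⁻¹ i) •
          ContinuousLinearMap.proj (R := ℂ) (φ := fun _ : Fin g => ℂ) i)) u := by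
      simp only [dotProduct_mulVec]
      apply HasFDerivAt.const_add
      apply HasFDerivAt.const_mul
      change HasFDerivAt (fun u : Fin g → ℂ => ∑ i, Matrix.vecMul M ω⁻¹ i * u i) _ u
      apply HasFDerivAt.fun_sum
      intro i _
      apply HasFDerivAt.const_mul
      exact hasFDerivAt_apply i u
    rw [kz_wder_exp_mul _ G u j hlin.differentiableAt (hGd u) hG0, hlin.fderiv]
    simp [Pi.single_apply]
  -- the imaginary part correction
  have him : (fun k => ((ω⁻¹.mulVec (u + l)) k).im)
      = (fun k => ((ω⁻¹.mulVec u) k).im)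
        + ((ω⁻¹ * ω').map Complex.im).mulVec (fun i => (mu i : ℝ)) := by
    rw [mulVec_add, hil]
    ext k
    simp [mulVec, dotProduct, hM]
  have hsymY : ((ω⁻¹ * ω').map Complex.im)ᵀ = (ω⁻¹ * ω').map Complex.im := by
    rw [← transpose_map, hsymm.eq]
  have hYu : IsUnit ((ω⁻¹ * ω').map Complex.im).det :=
    isUnit_iff_ne_zero.mpr hpos.det_pos.ne'
  have hcorr : Matrix.vecMul (fun k => ((ω⁻¹.mulVec (u + l)) k).im)
        (((ω⁻¹ * ω').map Complex.im)⁻¹)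
      = Matrix.vecMul (fun k => ((ω⁻¹.mulVec u) k).im) (((ω⁻¹ * ω').map Complex.im)⁻¹)
        + (fun i => (mu i : ℝ)) := by
    rw [him, add_vecMul]
    congr 1
    conv_lhs => rw [← hsymY, mulVec_transpose, hsymY, vecMul_vecMul, Matrix.mul_nonsing_inv _ hYu,
      vecMul_one]
  have hsplit : ∀ a : Fin g → ℝ, (fun i => (((a + (fun i => (mu i : ℝ))) i : ℝ) : ℂ))
      = (fun i => ((a i : ℝ) : ℂ)) + M := by
    intro a; ext i; simp [hM]
  unfold kleinZetaHat
  rw [hz _ _ hG0, hz _ _ hG1, hlog, hcorr, hsplit, add_vecMul (ω⁻¹) _ M, Pi.add_apply]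
  ring
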